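/- For every n ≥ 1 and every ℓ ∈ ℤ, ‖f_{ℓ−n,ℓ}‖ ≤ ∏_{k=1}^n ‖f_{ℓ−k,ℓ−k+1}‖, the sequence (‖f_{ℓ−k,ℓ−k+1}‖)_{k≥1} is stationary and ergodic, and there is a deterministic constant γ_− such that for a.e. e, lim_{n→∞} (1/n)·log‖f_{ℓ−n,ℓ}(e)‖ = γ_− ≤ E(log‖f_{0,1}‖) ≤ 0. Similarly, ‖f_{ℓ+n,ℓ}‖ ≤ ∏_{k=1}^n ‖f_{ℓ+k,ℓ+k−1}‖, the sequence (‖f_{ℓ+k,ℓ+k−1}‖)_{k≥1} is stationary and ergodic, and there is a deterministic constant γ_+ such that for a.e. e, lim_{n→∞} (1/n)·log‖f_{ℓ+n,ℓ}(e)‖ = γ_+ ≤ E(log‖f_{1,0}‖) ≤ 0. -/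

import Mathlib

open MeasureTheory Filter Matrix
open scoped ENNReal Topology

namespace Parrondo

/-- One-step transition probability of the regime-switching random walk:
`P_{αi,βj} = Q_{αβ} P^{(β)}_{ij}` with `P^{(β)}_{i,i+1} = p^{(β)}_i`,
`P^{(β)}_{i,i-1} = 1 - p^{(β)}_i`. -/
noncomputable def step {ι : Type*} (Q : Matrix ι ι ℝ) (p : ι → ℤ → ℝ) (s s' : ι × ℤ) : ℝ :=
  Q s.1 s'.1 *
    (if s'.2 = s.2 + 1 then p s'.1 s.2
     else if s'.2 = s.2 - 1 then 1 - p s'.1 s.2 else 0)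

/-- `μ α i` is the quenched law of the regime-switching walk `(G_n, X_n)` started at `(α, i)`,
characterized by its values on cylinder sets. -/
def IsQuenchedLaw {ι : Type*} [DecidableEq ι] [MeasurableSpace ι]
    (Q : Matrix ι ι ℝ) (p : ι → ℤ → ℝ) (μ : ι → ℤ → Measure (ℕ → ι × ℤ)) : Prop :=
  ∀ (α : ι) (i : ℤ),
    IsProbabilityMeasure (μ α i) ∧
    ∀ (n : ℕ) (traj : ℕ → ι × ℤ),
      μ α i {ω | ∀ k ≤ n, ω k = traj k} =
        (if traj 0 = (α, i) then 1 else 0) *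
          ENNReal.ofReal (∏ k ∈ Finset.range n, step Q p (traj k) (traj (k + 1)))

/-- The event `{τ_ℓ < ∞}` where `τ_ℓ = inf {n ≥ 1 : X_n = ℓ}`. -/
def hitEvent {ι : Type*} (ℓ : ℤ) : Set (ℕ → ι × ℤ) := {ω | ∃ n : ℕ, 1 ≤ n ∧ (ω n).2 = ℓ}

/-- The event `{τ_ℓ < ∞, G_{τ_ℓ} = β}`. -/
def hitRegimeEvent {ι : Type*} (ℓ : ℤ) (β : ι) : Set (ℕ → ι × ℤ) :=
  {ω | ∃ n : ℕ, 1 ≤ n ∧ (ω n).2 = ℓ ∧ (ω n).1 = β ∧ ∀ k, 1 ≤ k → k < n → (ω k).2 ≠ ℓ}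

/-- The event `{X_n ≤ ℓ infinitely often}`. -/
def belowIO {ι : Type*} (ℓ : ℤ) : Set (ℕ → ι × ℤ) := {ω | ∃ᶠ n in atTop, (ω n).2 ≤ ℓ}

/-- The event `{lim_n X_n = +∞}`. -/
def driftTop {ι : Type*} : Set (ℕ → ι × ℤ) := {ω | Tendsto (fun n => (ω n).2) atTop atTop}

/-- The event `{lim_n X_n = -∞}`. -/
def driftBot {ι : Type*} : Set (ℕ → ι × ℤ) := {ω | Tendsto (fun n => (ω n).2) atTop atBot}

/-- The event `{liminf_n X_n = -∞ and limsup_n X_n = +∞}`. -/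
def oscillate {ι : Type*} : Set (ℕ → ι × ℤ) :=
  {ω | (∀ M : ℤ, ∃ᶠ n in atTop, (ω n).2 < M) ∧ ∀ M : ℤ, ∃ᶠ n in atTop, M < (ω n).2}

/-- `‖f_{iℓ}‖ = max_α P_{αi}(τ_ℓ < ∞)`. -/
noncomputable def fnorm {ι : Type*} [Fintype ι] [MeasurableSpace ι]
    (μ : ι → ℤ → Measure (ℕ → ι × ℤ)) (i ℓ : ℤ) : ℝ :=
  ⨆ α : ι, (μ α i (hitEvent ℓ)).toReal

/-- One step of the chain `(G_n, X_n)` has positive probability (the probabilities `p` being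
in `(0,1)`, this only depends on `Q`). -/
def StepPos {ι : Type*} (Q : Matrix ι ι ℝ) (s s' : ι × ℤ) : Prop :=
  0 < Q s.1 s'.1 ∧ (s'.2 = s.2 + 1 ∨ s'.2 = s.2 - 1)

/-- Irreducibility of the Markov chain `(G_n, X_n)`. -/
def ChainIrreducible {ι : Type*} (Q : Matrix ι ι ℝ) : Prop :=
  ∀ s s' : ι × ℤ, ∃ (n : ℕ) (c : ℕ → ι × ℤ),
    c 0 = s ∧ c n = s' ∧ ∀ k < n, StepPos Q (c k) (c (k + 1))

/-- Irreducibility of the Markov chain `G_n` with transition matrix `Q`. -/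
def MatIrreducible {ι : Type*} (Q : Matrix ι ι ℝ) : Prop :=
  ∀ α β : ι, ∃ (n : ℕ) (g : ℕ → ι), g 0 = α ∧ g n = β ∧ ∀ k < n, 0 < Q (g k) (g (k + 1))

/-- One-step transition probability of a nearest-neighbour random walk on `ℤ`. -/
noncomputable def stepRW (p : ℤ → ℝ) (i j : ℤ) : ℝ :=
  if j = i + 1 then p i else if j = i - 1 then 1 - p i else 0

/-- `μ i` is the quenched law of the nearest-neighbour walk on `ℤ` started at `i`. -/
def IsRWLaw (p : ℤ → ℝ) (μ : ℤ → Measure (ℕ → ℤ)) : Prop :=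
  ∀ i : ℤ,
    IsProbabilityMeasure (μ i) ∧
    ∀ (n : ℕ) (traj : ℕ → ℤ),
      μ i {ω | ∀ k ≤ n, ω k = traj k} =
        (if traj 0 = i then 1 else 0) *
          ENNReal.ofReal (∏ k ∈ Finset.range n, stepRW p (traj k) (traj (k + 1)))

def driftTopZ : Set (ℕ → ℤ) := {ω | Tendsto ω atTop atTop}

def driftBotZ : Set (ℕ → ℤ) := {ω | Tendsto ω atTop atBot}

def oscillateZ : Set (ℕ → ℤ) :=
  {ω | (∀ M : ℤ, ∃ᶠ n in atTop, ω n < M) ∧ ∀ M : ℤ, ∃ᶠ n in atTop, M < ω n}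

/-- A norm on matrices (all norms being equivalent, the choice is irrelevant). -/
noncomputable def matNorm {ι : Type*} [Fintype ι] (B : Matrix ι ι ℝ) : ℝ :=
  ⨆ x : ι × ι, |B x.1 x.2|

/-- `prodA A n = A_n ⋯ A_1`. -/
def prodA {ι : Type*} [Fintype ι] [DecidableEq ι]
    (A : ℤ → Matrix ι ι ℝ) : ℕ → Matrix ι ι ℝ
  | 0 => 1
  | n + 1 => A ((n : ℤ) + 1) * prodA A n

/-- The Lyapunov exponent `lim_n n⁻¹ log ‖B_n v‖` (as a `limsup`, in `EReal`). -/
noncomputable def lyap {ι : Type*} [Fintype ι] (B : ℕ → Matrix ι ι ℝ) (v : ι → ℝ) : EReal :=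
  Filter.limsup (fun n : ℕ => ((Real.log ‖B n *ᵥ v‖ / n : ℝ) : EReal)) Filter.atTop

/-- `V̄_0 = {v : lim_n n⁻¹ log ‖B_n v‖ ≤ 0}`. -/
def V0 {ι : Type*} [Fintype ι] (B : ℕ → Matrix ι ι ℝ) : Set (ι → ℝ) := {v | lyap B v ≤ 0}

/-- `V̄_{0-} = {v : lim_n n⁻¹ log ‖B_n v‖ < 0}`. -/
def V0minus {ι : Type*} [Fintype ι] (B : ℕ → Matrix ι ι ℝ) : Set (ι → ℝ) := {v | lyap B v < 0}

/-- `S` is a linear subspace of dimension `d`. -/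
def HasDim {ι : Type*} [Fintype ι] (S : Set (ι → ℝ)) (d : ℕ) : Prop :=
  ∃ W : Submodule ℝ (ι → ℝ), (W : Set (ι → ℝ)) = S ∧ Module.finrank ℝ W = d

/-- The `2m × 2m` matrix `A_i = [[M_i⁻¹, -σ_i],[I, 0]]` with `M_i = QΔ_i`, `N_i = Q(I - Δ_i)`,
`σ_i = M_i⁻¹ N_i`, where `p` lists the diagonal entries of `Δ_i`. -/
noncomputable def Afull {m : ℕ} (Q : Matrix (Fin m) (Fin m) ℝ) (p : Fin m → ℝ) :
    Matrix (Fin m ⊕ Fin m) (Fin m ⊕ Fin m) ℝ :=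
  Matrix.fromBlocks (Q * Matrix.diagonal p)⁻¹
    (-((Q * Matrix.diagonal p)⁻¹ * (Q * (1 - Matrix.diagonal p)))) 1 0

/-- `M̌_i = π⁽¹⁾Δ_i⁽¹⁾ + π⁽²⁾Δ_i⁽²⁾Θ`. -/
noncomputable def Mcheck {r s : ℕ} (π : Matrix (Fin r) (Fin r ⊕ Fin s) ℝ)
    (Θ : Matrix (Fin s) (Fin r) ℝ) (p : Fin r ⊕ Fin s → ℝ) : Matrix (Fin r) (Fin r) ℝ :=
  (Matrix.of fun a c => π a (Sum.inl c)) * Matrix.diagonal (fun c => p (Sum.inl c)) +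
    (Matrix.of fun a b => π a (Sum.inr b)) * Matrix.diagonal (fun b => p (Sum.inr b)) * Θ

/-- `Ň_i = π⁽¹⁾(I - Δ_i⁽¹⁾) + π⁽²⁾(I - Δ_i⁽²⁾)Θ`. -/
noncomputable def Ncheck {r s : ℕ} (π : Matrix (Fin r) (Fin r ⊕ Fin s) ℝ)
    (Θ : Matrix (Fin s) (Fin r) ℝ) (p : Fin r ⊕ Fin s → ℝ) : Matrix (Fin r) (Fin r) ℝ :=
  (Matrix.of fun a c => π a (Sum.inl c)) * (1 - Matrix.diagonal (fun c => p (Sum.inl c))) +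
    (Matrix.of fun a b => π a (Sum.inr b)) * (1 - Matrix.diagonal (fun b => p (Sum.inr b))) * Θ

/-- The `2r × 2r` matrix `Ǎ_i = [[M̌_i⁻¹, -σ̌_i],[I, 0]]` with `σ̌_i = M̌_i⁻¹ Ň_i`. -/
noncomputable def Acheck {r s : ℕ} (π : Matrix (Fin r) (Fin r ⊕ Fin s) ℝ)
    (Θ : Matrix (Fin s) (Fin r) ℝ) (p : Fin r ⊕ Fin s → ℝ) :
    Matrix (Fin r ⊕ Fin r) (Fin r ⊕ Fin r) ℝ :=
  Matrix.fromBlocks (Mcheck π Θ p)⁻¹ (-((Mcheck π Θ p)⁻¹ * Ncheck π Θ p)) 1 0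

/-- The event `{𝒩_ℓ ≥ k} = {τ_ℓ^{(k)} < ∞}`: there are at least `k` visits of `X` to `ℓ`
(at times `≥ 1`). -/
def visitsAtLeast {ι : Type*} (ℓ : ℤ) (k : ℕ) : Set (ℕ → ι × ℤ) :=
  {ω | ∃ s : Fin k → ℕ, StrictMono s ∧ ∀ j, 1 ≤ s j ∧ (ω (s j)).2 = ℓ}

/-- The event `{τ_ℓ^{(k+1)} < ∞, G_{τ_ℓ^{(k+1)}} = β}`: the walk visits `ℓ` at least `k+1` times
and the regime at the `(k+1)`-th visit is `β`. -/
def kthVisitInRegime {ι : Type*} (ℓ : ℤ) (k : ℕ) (β : ι) : Set (ℕ → ι × ℤ) :=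
  {ω | ∃ s : Fin (k + 1) → ℕ, StrictMono s ∧ (∀ j, 1 ≤ s j ∧ (ω (s j)).2 = ℓ) ∧
    (ω (s (Fin.last k))).1 = β ∧
    ∀ n : ℕ, 1 ≤ n → n ≤ s (Fin.last k) → (ω n).2 = ℓ → ∃ j, s j = n}

/-- The shift on real sequences. -/
def shiftSeq : (ℕ → ℝ) → (ℕ → ℝ) := fun x n => x (n + 1)

/-! ### Superadditive ergodic theorem for nonnegative processes -/

section Superadditive

variable {Ω : Type*} {T : Ω → Ω} {b : ℕ → Ω → ℝ≥0∞}

/-- `b` is a superadditive cocycle over `T`. -/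
def IsSuperadditive (T : Ω → Ω) (b : ℕ → Ω → ℝ≥0∞) : Prop :=
  ∀ m n x, 0 < m → 0 < n → b m x + b n (T^[m] x) ≤ b (m + n) x

/-- The points at which some average `b l x / l` with `1 ≤ l ≤ N` is at least `d`. -/
def largeAverageSet (b : ℕ → Ω → ℝ≥0∞) (d : ℝ≥0∞) (N : ℕ) : Set Ω :=
  {x | ∃ l : ℕ, 1 ≤ l ∧ l ≤ N ∧ l * d ≤ b l x}

theorem birkhoffSum_indicator_le (hb : IsSuperadditive T b) (d : ℝ≥0∞) (N : ℕ) (n : ℕ) (x : Ω) :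
    birkhoffSum T ((largeAverageSet b d N).indicator fun _ => d) n x ≤ b n x + N * d := by
  have hle : ∀ n x, birkhoffSum T ((largeAverageSet b d N).indicator fun _ => d) n x ≤ n * d := by
    intro n x
    calc birkhoffSum T ((largeAverageSet b d N).indicator fun _ => d) n x
        ≤ ∑ _i ∈ Finset.range n, d :=
          Finset.sum_le_sum fun i _ => Set.indicator_le_self' (fun _ _ => zero_le) _
      _ = n * d := by simp
  induction n using Nat.strong_induction_on generalizing x with
  | _ n ih =>
    rcases Nat.eq_zero_or_pos n with rfl | hn
    · simp
    by_cases hx : x ∈ largeAverageSet b d N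
    · obtain ⟨l, hl1, hlN, hl⟩ := id hx
      rcases lt_or_ge l n with hln | hnl
      · obtain ⟨r, rfl⟩ := Nat.exists_eq_add_of_lt hln
        rw [add_assoc, birkhoffSum_add]
        calc _ ≤ l * d + (b (r + 1) (T^[l] x) + N * d) := add_le_add (hle _ _) (ih _ (by omega) _)
          _ ≤ b l x + (b (r + 1) (T^[l] x) + N * d) := by gcongr
          _ = (b l x + b (r + 1) (T^[l] x)) + N * d := by ring
          _ ≤ _ := by gcongr; exact hb _ _ _ (by omega) (by omega)
      · calc _ ≤ n * d := hle _ _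
          _ ≤ N * d := by gcongr; omega
          _ ≤ _ := le_add_self
    · obtain ⟨r, rfl⟩ := Nat.exists_eq_add_of_lt hn
      rw [zero_add, birkhoffSum_succ', Set.indicator_of_notMem hx, zero_add]
      rcases Nat.eq_zero_or_pos r with rfl | hr
      · simp
      · calc _ ≤ b r (T x) + N * d := ih _ (by omega) _
          _ ≤ _ := by
            gcongr
            rw [add_comm]
            exact le_add_self.trans (hb 1 r x one_pos hr)

theorem limsup_average_comp_le (hb : IsSuperadditive T b) (x : Ω) :
    limsup (fun n : ℕ => b n (T x) / n) atTop ≤ limsup (fun n : ℕ => b n x / n) atTop := by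
  refine le_of_forall_gt fun r hr => ?_
  obtain ⟨s, hs, hsr⟩ := exists_between hr
  refine lt_of_le_of_lt ?_ hsr
  have h1 : ∀ᶠ n : ℕ in atTop, b (n + 1) x / (n + 1 : ℕ) < s :=
    (tendsto_add_atTop_nat 1).eventually (eventually_lt_of_limsup_lt hs)
  have h2 : ∀ᶠ n : ℕ in atTop, b n (T x) / n ≤ s * ((n + 1 : ℕ) / n) := by
    filter_upwards [h1, eventually_gt_atTop 0] with n hn hpos
    have h3 : b n (T x) ≤ b (n + 1) x := by
      have := hb 1 n x one_pos hpos
      rw [add_comm 1 n] at this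
      exact le_add_self.trans this
    have h4 : b (n + 1) x ≤ s * (n + 1 : ℕ) :=
      (ENNReal.div_le_iff (by simp) (by simp)).1 hn.le
    calc b n (T x) / n ≤ s * (n + 1 : ℕ) / n := by gcongr; exact h3.trans h4
      _ = _ := mul_div_assoc _ _ _
  have h5 : Tendsto (fun n : ℕ => s * (((n + 1 : ℕ) : ℝ≥0∞) / n)) atTop (𝓝 (s * 1)) := by
    refine ENNReal.Tendsto.const_mul ?_ (.inl one_ne_zero)
    have : Tendsto (fun n : ℕ => 1 + (n : ℝ≥0∞)⁻¹) atTop (𝓝 (1 + 0)) :=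
      tendsto_const_nhds.add ENNReal.tendsto_inv_nat_nhds_zero
    rw [add_zero] at this
    refine this.congr' ?_
    filter_upwards [eventually_gt_atTop 0] with n hn
    rw [Nat.cast_succ, ENNReal.add_div, ENNReal.div_self (by simp; omega) (by simp), one_div]
  rw [mul_one] at h5
  exact (limsup_le_limsup h2).trans h5.limsup_eq.le

theorem isSuperadditive_birkhoffSum (T : Ω → Ω) (φ : Ω → ℝ≥0∞) :
    IsSuperadditive T (birkhoffSum T φ) := fun m n x _ _ => (birkhoffSum_add T φ m n x).ge

variable [MeasurableSpace Ω] {P : Measure Ω}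

theorem measurableSet_largeAverageSet (hbm : ∀ n, Measurable (b n)) (d : ℝ≥0∞) (N : ℕ) :
    MeasurableSet (largeAverageSet b d N) := by
  have : largeAverageSet b d N = ⋃ l : ℕ, ⋃ _ : 1 ≤ l ∧ l ≤ N, {x | l * d ≤ b l x} := by
    ext x
    simp [largeAverageSet, and_assoc]
  rw [this]
  exact .iUnion fun l => .iUnion fun _ => measurableSet_le measurable_const (hbm l)

theorem measurable_limsup_average (hbm : ∀ n, Measurable (b n)) :
    Measurable fun x => limsup (fun n : ℕ => b n x / n) atTop :=
  .limsup fun n => (hbm n).div_const _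

/-- The limsup of the averages of a superadditive cocycle. -/
noncomputable def upperRate (P : Measure Ω) (b : ℕ → Ω → ℝ≥0∞) : ℝ≥0∞ :=
  essSup (fun x => limsup (fun n : ℕ => b n x / n) atTop) P

theorem ae_limsup_le_upperRate :
    ∀ᵐ x ∂P, limsup (fun n : ℕ => b n x / n) atTop ≤ upperRate P b :=
  ENNReal.ae_le_essSup _

theorem measurable_birkhoffSum (hT : Measurable T) {φ : Ω → ℝ≥0∞} (hφ : Measurable φ) (n : ℕ) :
    Measurable (birkhoffSum T φ n) := by
  unfold birkhoffSum
  exact Finset.measurable_sum _ fun i _ => hφ.comp (hT.iterate i)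

theorem lintegral_birkhoffSum (hT : MeasurePreserving T P P) {φ : Ω → ℝ≥0∞} (hφ : Measurable φ)
    (n : ℕ) : ∫⁻ x, birkhoffSum T φ n x ∂P = n * ∫⁻ x, φ x ∂P := by
  unfold birkhoffSum
  rw [lintegral_finsetSum (f := fun k x => φ (T^[k] x)) _
    fun i _ => hφ.comp (hT.measurable.iterate i)]
  simp [(hT.iterate _).lintegral_comp hφ]

variable [IsProbabilityMeasure P]

theorem ae_lt_limsup_of_lt_upperRate (hT : Ergodic T P) (hbm : ∀ n, Measurable (b n))
    (hb : IsSuperadditive T b) {d : ℝ≥0∞} (hd : d < upperRate P b) :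
    ∀ᵐ x ∂P, d < limsup (fun n : ℕ => b n x / n) atTop := by
  set s : Set Ω := {x | d < limsup (fun n : ℕ => b n x / n) atTop}
  have hs : MeasurableSet s := measurableSet_lt measurable_const (measurable_limsup_average hbm)
  rcases hT.ae_empty_or_univ_of_preimage_ae_le hs.nullMeasurableSet
    (Eventually.of_forall fun x hx => lt_of_lt_of_le hx (limsup_average_comp_le hb x)) with h | h
  · refine absurd hd (not_lt.2 (essSup_le_of_ae_le _ ?_))
    filter_upwards [h.mem_iff] with x hx
    exact not_lt.1 fun h' => hx.1 h'
  · filter_upwards [h.mem_iff] with x hx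
    exact hx.2 trivial

theorem tendsto_measure_largeAverageSet (hT : Ergodic T P) (hbm : ∀ n, Measurable (b n))
    (hb : IsSuperadditive T b) {d : ℝ≥0∞} (hd : d < upperRate P b) :
    Tendsto (fun N => P (largeAverageSet b d N)) atTop (𝓝 1) := by
  have hmono : Monotone (largeAverageSet b d) := fun N M h x ⟨l, h1, h2, h3⟩ =>
    ⟨l, h1, h2.trans h, h3⟩
  have hU : P (⋃ N, largeAverageSet b d N) = 1 := by
    rw [prob_compl_eq_zero_iff₀ (MeasurableSet.iUnion fun N =>
      measurableSet_largeAverageSet hbm d N).nullMeasurableSet |>.symm]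
    filter_upwards [ae_lt_limsup_of_lt_upperRate hT hbm hb hd] with x hx
    have h1 := (frequently_lt_of_lt_limsup (h := hx)).and_eventually (eventually_gt_atTop 0)
    obtain ⟨l, hl, hl0⟩ := h1.exists
    refine Set.mem_iUnion.2 ⟨l, l, hl0, le_rfl, ?_⟩
    rw [mul_comm]
    exact (ENNReal.le_div_iff_mul_le (by simp; omega) (by simp)).1 hl.le
  exact hU ▸ tendsto_measure_iUnion_atTop hmono

theorem upperRate_birkhoffSum_le (hT : Ergodic T P) {φ : Ω → ℝ≥0∞} (hφ : Measurable φ) :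
    upperRate P (birkhoffSum T φ) ≤ ∫⁻ x, φ x ∂P := by
  refine le_of_forall_lt fun d hd => ?_
  obtain ⟨d', hdd', hd'⟩ := exists_between hd
  refine hdd'.trans_le ?_
  have hbm := measurable_birkhoffSum hT.measurable hφ
  have hb := isSuperadditive_birkhoffSum T φ
  have hlim : Tendsto (fun N => d' * P (largeAverageSet (birkhoffSum T φ) d' N)) atTop
      (𝓝 (d' * 1)) :=
    ENNReal.Tendsto.const_mul (tendsto_measure_largeAverageSet hT hbm hb hd') (.inl one_ne_zero)
  rw [mul_one] at hlim
  refine le_of_tendsto' hlim fun N => ?_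
  have hG := measurableSet_largeAverageSet hbm d' N
  have key : ∀ n : ℕ, 0 < n → d' * P (largeAverageSet (birkhoffSum T φ) d' N) ≤
      (∫⁻ x, φ x ∂P) + N * d' * (n : ℝ≥0∞)⁻¹ := by
    intro n hn
    have h := lintegral_mono (μ := P) fun x => birkhoffSum_indicator_le hb d' N n x
    rw [lintegral_birkhoffSum hT.toMeasurePreserving (measurable_const.indicator hG),
      lintegral_indicator_const hG, lintegral_add_right _ measurable_const,
      lintegral_birkhoffSum hT.toMeasurePreserving hφ, lintegral_const, measure_univ, mul_one] at h
    have hn0 : (n : ℝ≥0∞) ≠ 0 := by simp; omega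
    have hnt : (n : ℝ≥0∞) ≠ ∞ := by simp
    have h' := mul_le_mul_left h (n : ℝ≥0∞)⁻¹
    rwa [add_mul, mul_comm (n : ℝ≥0∞), mul_assoc, ENNReal.mul_inv_cancel hn0 hnt, mul_one,
      mul_comm (n : ℝ≥0∞), mul_assoc (lintegral _ _), ENNReal.mul_inv_cancel hn0 hnt, mul_one] at h'
  have hlim' : Tendsto (fun n : ℕ => (∫⁻ x, φ x ∂P) + N * d' * (n : ℝ≥0∞)⁻¹) atTop
      (𝓝 ((∫⁻ x, φ x ∂P) + N * d' * 0)) :=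
    tendsto_const_nhds.add (ENNReal.Tendsto.const_mul ENNReal.tendsto_inv_nat_nhds_zero
      (.inr (ENNReal.mul_ne_top (by simp) hd'.ne_top)))
  rw [mul_zero, add_zero] at hlim'
  exact ge_of_tendsto hlim' ((eventually_gt_atTop 0).mono key)

theorem ae_lintegral_le_liminf_birkhoffSum (hT : Ergodic T P) {φ : Ω → ℝ≥0∞} (hφ : Measurable φ)
    {K : ℝ≥0∞} (hK : K ≠ ∞) (hφK : ∀ x, φ x ≤ K) :
    ∀ᵐ x ∂P, ∫⁻ x, φ x ∂P ≤ liminf (fun n : ℕ => birkhoffSum T φ n x / n) atTop := by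
  have hψ : Measurable fun x => K - φ x := measurable_const.sub hφ
  have hint : ∫⁻ x, φ x ∂P + ∫⁻ x, (K - φ x) ∂P = K := by
    rw [← lintegral_add_left hφ]
    simp [add_tsub_cancel_of_le (hφK _)]
  filter_upwards [ae_limsup_le_upperRate (P := P) (b := birkhoffSum T fun x => K - φ x)] with x hx
  have hsum : ∀ n : ℕ, 0 < n →
      birkhoffSum T φ n x / n = K - birkhoffSum T (fun x => K - φ x) n x / n := by
    intro n hn
    have hn0 : (n : ℝ≥0∞) ≠ 0 := by simp; omega
    have h1 : birkhoffSum T φ n x + birkhoffSum T (fun x => K - φ x) n x = n * K := by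
      simp [birkhoffSum, ← Finset.sum_add_distrib, add_tsub_cancel_of_le (hφK _)]
    have h2 : birkhoffSum T φ n x / n + birkhoffSum T (fun x => K - φ x) n x / n = K := by
      rw [← ENNReal.add_div, h1, mul_comm, ENNReal.mul_div_cancel_right hn0 (by simp)]
    refine ENNReal.eq_sub_of_add_eq ?_ h2
    exact ne_top_of_le_ne_top hK (le_add_self.trans_eq h2)
  have h3 : liminf (fun n : ℕ => birkhoffSum T φ n x / n) atTop =
      K - limsup (fun n : ℕ => birkhoffSum T (fun x => K - φ x) n x / n) atTop := by
    rw [← ENNReal.liminf_const_sub _ _ hK]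
    exact liminf_congr ((eventually_gt_atTop 0).mono hsum)
  rw [h3]
  have hψK : ∫⁻ x, (K - φ x) ∂P ≠ ∞ := ne_top_of_le_ne_top hK (le_add_self.trans_eq hint)
  rw [ENNReal.eq_sub_of_add_eq hψK hint]
  exact tsub_le_tsub_left (hx.trans (upperRate_birkhoffSum_le hT hψ)) _

/-- The superadditive ergodic theorem for nonnegative cocycles over an ergodic map. -/
theorem exists_tendsto_of_isSuperadditive (hT : Ergodic T P) (hbm : ∀ n, Measurable (b n))
    (hb : IsSuperadditive T b) :
    ∃ γ : ℝ≥0∞, ∫⁻ x, b 1 x ∂P ≤ γ ∧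
      ∀ᵐ x ∂P, Tendsto (fun n : ℕ => b n x / n) atTop (𝓝 γ) := by
  refine ⟨upperRate P b, ?_, ?_⟩
  · have hK : ∀ K : ℕ, ∫⁻ x, min (b 1 x) K ∂P ≤ upperRate P b := by
      intro K
      obtain ⟨x, hx1, hx2⟩ := ((ae_lintegral_le_liminf_birkhoffSum hT
        ((hbm 1).min measurable_const) (ENNReal.natCast_ne_top K)
        fun x => min_le_right _ _).and (ae_limsup_le_upperRate (P := P) (b := b))).exists
      refine hx1.trans (le_trans ?_ ((liminf_le_limsup).trans hx2))
      refine liminf_le_liminf ((eventually_gt_atTop 0).mono fun n hn => ?_)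
      gcongr
      clear hx1 hx2
      induction n, hn using Nat.le_induction generalizing x with
      | base => simp [birkhoffSum_one']
      | succ n hn ih =>
        rw [birkhoffSum_succ', add_comm n 1]
        exact (add_le_add (min_le_left _ _) (ih _)).trans (hb 1 n x one_pos hn)
    have hsup : ∀ x, b 1 x = ⨆ K : ℕ, min (b 1 x) K := by
      intro x
      rw [← inf_iSup_eq, ENNReal.iSup_natCast, inf_top_eq]
    rw [lintegral_congr hsup]
    rw [lintegral_iSup (fun K => (hbm 1).min measurable_const)
      fun K L h x => min_le_min le_rfl (by exact_mod_cast h)]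
    exact iSup_le hK
  · have hlow : ∀ d < upperRate P b, ∀ᵐ x ∂P, d ≤ liminf (fun n : ℕ => b n x / n) atTop := by
      intro d hd
      have hdt : d ≠ ∞ := hd.ne_top
      have h1 : ∀ᵐ x ∂P, ∀ N, d * P (largeAverageSet b d N) ≤
          liminf (fun n : ℕ => b n x / n) atTop := by
        refine ae_all_iff.2 fun N => ?_
        have hG := measurableSet_largeAverageSet hbm d N
        filter_upwards [ae_lintegral_le_liminf_birkhoffSum hT
          (measurable_const.indicator hG) hdt
          fun x => Set.indicator_le_self' (fun _ _ => zero_le) x] with x hx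
        rw [lintegral_indicator_const hG] at hx
        refine hx.trans ?_
        have h2 : Tendsto (fun n : ℕ => N * d / (n : ℝ≥0∞)) atTop (𝓝 0) := by
          have := ENNReal.Tendsto.const_mul (a := N * d) ENNReal.tendsto_inv_nat_nhds_zero
            (.inr (ENNReal.mul_ne_top (by simp) hdt))
          rw [mul_zero] at this
          exact this
        rw [← ENNReal.liminf_add_of_right_tendsto_zero h2 fun n => b n x / n]
        refine liminf_le_liminf (Eventually.of_forall fun n => ?_)
        rw [Pi.add_apply, ← ENNReal.add_div]
        gcongr
        exact birkhoffSum_indicator_le hb d N n x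
      filter_upwards [h1] with x hx
      have hlim := ENNReal.Tendsto.const_mul (a := d)
        (tendsto_measure_largeAverageSet hT hbm hb hd) (.inl one_ne_zero)
      rw [mul_one] at hlim
      exact le_of_tendsto' hlim hx
    have hlow' : ∀ᵐ x ∂P, upperRate P b ≤ liminf (fun n : ℕ => b n x / n) atTop := by
      rcases eq_or_ne (upperRate P b) 0 with h0 | h0
      · simp [h0]
      obtain ⟨u, -, hu, hlim⟩ := exists_seq_strictMono_tendsto' (pos_iff_ne_zero.2 h0)
      filter_upwards [ae_all_iff.2 fun k => hlow (u k) (hu k).2] with x hx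
      exact le_of_tendsto' hlim hx
    filter_upwards [hlow', ae_limsup_le_upperRate (P := P) (b := b)] with x h1 h2
    exact tendsto_of_le_liminf_of_limsup_le h1 h2

end Superadditive

/-! ### Factors of ergodic maps -/

/-- A factor map that conjugates `T` to an inverse of `S` transports ergodicity of `T` to `S`. -/
theorem ergodic_map_of_comp_comp_eq {Ω Y : Type*} [MeasurableSpace Ω] [MeasurableSpace Y]
    {P : Measure Ω} {T : Ω → Ω} {S : Y → Y} {φ : Ω → Y} (hT : Ergodic T P) (hφ : Measurable φ)
    (hS : Measurable S) (h : ∀ x, S (φ (T x)) = φ x) : Ergodic S (P.map φ) where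
  measurable := hS
  map_eq := by
    conv_lhs => rw [← hT.map_eq]
    rw [Measure.map_map hφ hT.measurable, Measure.map_map hS (hφ.comp hT.measurable)]
    congr 1
    exact funext h
  aeconst_set s hs hs' := by
    rw [← (hφ.measurePreserving P).aeconst_preimage hs.nullMeasurableSet]
    refine hT.aeconst_set (hφ hs) (Set.ext fun x => ?_)
    have : φ (T x) ∈ S ⁻¹' s ↔ φ (T x) ∈ s := by rw [hs']
    rw [Set.mem_preimage, Set.mem_preimage, Set.mem_preimage, ← this, Set.mem_preimage, h]

/-! ### Hitting probabilities by first-step analysis -/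

section Hitting

variable {ι : Type*}

theorem step_nonneg {Q : Matrix ι ι ℝ} {p : ι → ℤ → ℝ} (hQ : ∀ α β, 0 ≤ Q α β)
    (hp : ∀ α k, p α k ∈ Set.Ioo (0 : ℝ) 1) (s s' : ι × ℤ) : 0 ≤ step Q p s s' := by
  unfold step
  have := hp s'.1 s.2
  refine mul_nonneg (hQ _ _) ?_
  split_ifs
  exacts [this.1.le, by linarith [this.2], le_rfl]

theorem step_eq_zero {Q : Matrix ι ι ℝ} {p : ι → ℤ → ℝ} {s s' : ι × ℤ}
    (h1 : s'.2 ≠ s.2 + 1) (h2 : s'.2 ≠ s.2 - 1) : step Q p s s' = 0 := by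
  simp [step, h1, h2]

theorem step_pos {Q : Matrix ι ι ℝ} {p : ι → ℤ → ℝ} (hp : ∀ α k, p α k ∈ Set.Ioo (0 : ℝ) 1)
    {s s' : ι × ℤ} (h : StepPos Q s s') : 0 < step Q p s s' := by
  unfold step
  have := hp s'.1 s.2
  refine mul_pos h.1 ?_
  split_ifs with h1 h2
  exacts [this.1, by linarith [this.2], absurd h.2 (by tauto)]

/-- The probability that the walk started at `s` visits `ℓ` at a time in `[1, N]`. -/
noncomputable def hitProb (Q : Matrix ι ι ℝ) (p : ι → ℤ → ℝ) (ℓ : ℤ) : ℕ → ι × ℤ → ℝ≥0∞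
  | 0, _ => 0
  | N + 1, s => ∑' s', ENNReal.ofReal (step Q p s s') *
      open Classical in if s'.2 = ℓ then 1 else hitProb Q p ℓ N s'

/-- The probability that the walk visits `j` from `i`, maximized over the initial regime. -/
noncomputable def hitSup (Q : Matrix ι ι ℝ) (p : ι → ℤ → ℝ) (i j : ℤ) : ℝ≥0∞ :=
  ⨆ α : ι, ⨆ N : ℕ, hitProb Q p j N (α, i)

theorem hitProb_le_hitSup (Q : Matrix ι ι ℝ) (p : ι → ℤ → ℝ) (i j : ℤ) (N : ℕ) (α : ι) :
    hitProb Q p j N (α, i) ≤ hitSup Q p i j :=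
  le_iSup_of_le α (le_iSup_of_le N le_rfl)

theorem hitProb_le_mul (Q : Matrix ι ι ℝ) (p : ι → ℤ → ℝ) (j k : ℤ) (N : ℕ) (s : ι × ℤ)
    (h : s.2 < j ∧ j < k ∨ k < j ∧ j < s.2) :
    hitProb Q p k N s ≤ hitProb Q p j N s * hitSup Q p j k := by
  induction N generalizing s with
  | zero => simp [hitProb]
  | succ N ih =>
    simp only [hitProb]
    rw [← ENNReal.tsum_mul_right]
    refine ENNReal.tsum_le_tsum fun s' => ?_
    by_cases hs : s'.2 = s.2 + 1 ∨ s'.2 = s.2 - 1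
    · rw [mul_assoc]
      gcongr
      rw [if_neg (by omega)]
      split_ifs with hj
      · rw [one_mul, ← hj]
        exact hitProb_le_hitSup Q p _ _ _ _
      · exact ih s' (by omega)
    · rw [not_or] at hs
      simp [step_eq_zero hs.1 hs.2]

theorem hitSup_le_mul (Q : Matrix ι ι ℝ) (p : ι → ℤ → ℝ) {i j k : ℤ}
    (h : i < j ∧ j < k ∨ k < j ∧ j < i) :
    hitSup Q p i k ≤ hitSup Q p i j * hitSup Q p j k := by
  refine iSup_le fun α => iSup_le fun N => (hitProb_le_mul Q p j k N (α, i) h).trans ?_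
  gcongr
  exact hitProb_le_hitSup Q p _ _ _ _

theorem hitProb_shift (Q : Matrix ι ι ℝ) (p : ι → ℤ → ℝ) (ℓ : ℤ) (N : ℕ) (s : ι × ℤ) :
    hitProb Q (fun α k => p α (k + 1)) ℓ N s = hitProb Q p (ℓ + 1) N (s.1, s.2 + 1) := by
  induction N generalizing s with
  | zero => simp [hitProb]
  | succ N ih =>
    simp only [hitProb]
    symm
    rw [← ((Equiv.refl ι).prodCongr (Equiv.addRight (1 : ℤ))).tsum_eq]
    refine tsum_congr fun s' => ?_
    simp only [ih, step, Equiv.prodCongr_apply, Prod.map, Equiv.refl_apply, Equiv.coe_addRight,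
      add_left_inj, ← sub_add_eq_add_sub]

theorem hitSup_shift (Q : Matrix ι ι ℝ) (p : ι → ℤ → ℝ) (i j : ℤ) :
    hitSup Q (fun α k => p α (k + 1)) i j = hitSup Q p (i + 1) (j + 1) := by
  simp [hitSup, hitProb_shift]

theorem measurable_hitProb [Countable ι] {E : Type*} [MeasurableSpace E] (Q : Matrix ι ι ℝ)
    {p : ι → ℤ → E → ℝ} (hp : ∀ α k, Measurable (p α k)) (ℓ : ℤ) (N : ℕ) (s : ι × ℤ) :
    Measurable fun e => hitProb Q (fun α k => p α k e) ℓ N s := by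
  induction N generalizing s with
  | zero => exact measurable_const
  | succ N ih =>
    simp only [hitProb]
    refine Measurable.tsum fun s' => Measurable.mul ?_ ?_
    · refine (Measurable.const_mul ?_ _).ennreal_ofReal
      split_ifs
      exacts [hp _ _, measurable_const.sub (hp _ _), measurable_const]
    · split_ifs
      exacts [measurable_const, ih s']

theorem measurable_hitSup [Countable ι] {E : Type*} [MeasurableSpace E] (Q : Matrix ι ι ℝ)
    {p : ι → ℤ → E → ℝ} (hp : ∀ α k, Measurable (p α k)) (i j : ℤ) :
    Measurable fun e => hitSup Q (fun α k => p α k e) i j :=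
  .iSup fun α => .iSup fun N => measurable_hitProb Q hp j N (α, i)

theorem hitProb_pos [Fintype ι] {Q : Matrix ι ι ℝ} {p : ι → ℤ → ℝ}
    (hQ1 : ∀ α, ∑ β, Q α β = 1) (hp : ∀ α k, p α k ∈ Set.Ioo (0 : ℝ) 1)
    (ℓ : ℤ) (n : ℕ) (s : ι × ℤ) (h : (s.2 - ℓ).natAbs = n + 1) :
    0 < hitProb Q p ℓ (n + 1) s := by
  induction n generalizing s with
  | zero =>
    obtain ⟨β, hβ⟩ : ∃ β, 0 < Q s.1 β := by
      by_contra! hcon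
      linarith [hQ1 s.1, Finset.sum_nonpos fun β (_ : β ∈ Finset.univ) => hcon β]
    have hpos := step_pos hp (s := s) (s' := (β, ℓ)) ⟨hβ, by dsimp only; omega⟩
    rw [hitProb]
    refine lt_of_lt_of_le ?_ (ENNReal.le_tsum (β, ℓ))
    simpa using hpos
  | succ n ih =>
    obtain ⟨β, hβ⟩ : ∃ β, 0 < Q s.1 β := by
      by_contra! hcon
      linarith [hQ1 s.1, Finset.sum_nonpos fun β (_ : β ∈ Finset.univ) => hcon β]
    obtain ⟨i, hi, hi'⟩ : ∃ i : ℤ, (i = s.2 + 1 ∨ i = s.2 - 1) ∧ (i - ℓ).natAbs = n + 1 := by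
      rcases lt_or_ge s.2 ℓ with h' | h'
      exacts [⟨s.2 + 1, by omega, by omega⟩, ⟨s.2 - 1, by omega, by omega⟩]
    have hpos := step_pos hp (s := s) (s' := (β, i)) ⟨hβ, hi⟩
    rw [hitProb]
    refine lt_of_lt_of_le ?_ (ENNReal.le_tsum (β, i))
    rw [if_neg (by dsimp only; omega)]
    exact ENNReal.mul_pos (by simpa using hpos) (ih (β, i) hi').ne'

theorem hitSup_pos [Fintype ι] [Nonempty ι] {Q : Matrix ι ι ℝ} {p : ι → ℤ → ℝ}
    (hQ1 : ∀ α, ∑ β, Q α β = 1) (hp : ∀ α k, p α k ∈ Set.Ioo (0 : ℝ) 1)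
    {i j : ℤ} (h : i ≠ j) : 0 < hitSup Q p i j := by
  inhabit ι
  obtain ⟨n, hn⟩ : ∃ n, (i - j).natAbs = n + 1 := ⟨(i - j).natAbs - 1, by omega⟩
  exact (hitProb_pos hQ1 hp j n (default, i) hn).trans_le (hitProb_le_hitSup Q p _ _ _ _)

end Hitting

/-! ### The quenched law -/

section Law

theorem measurableSet_cylinder {S : Type*} [MeasurableSpace S] [MeasurableSingletonClass S]
    (n : ℕ) (t : ℕ → S) : MeasurableSet {ω : ℕ → S | ∀ k ≤ n, ω k = t k} := by
  have : {ω : ℕ → S | ∀ k ≤ n, ω k = t k} = ⋂ k, ⋂ _ : k ≤ n, (fun ω => ω k) ⁻¹' {t k} := by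
    ext ω
    simp
  rw [this]
  exact .iInter fun k => .iInter fun _ => measurable_pi_apply k (measurableSet_singleton (t k))

theorem measurableSet_exists_visit {ι : Type*} [MeasurableSpace ι] (n N : ℕ) (ℓ : ℤ) :
    MeasurableSet {ω : ℕ → ι × ℤ | ∃ k, n < k ∧ k ≤ n + N ∧ (ω k).2 = ℓ} := by
  simp only [Set.ofPred_exists, Set.ofPred_and]
  exact .iUnion fun k => (MeasurableSet.const _).inter ((MeasurableSet.const _).inter
    (measurable_snd.comp (measurable_pi_apply k) (measurableSet_singleton ℓ)))

variable {ι : Type*} [DecidableEq ι] [MeasurableSpace ι] [Fintype ι] [MeasurableSingletonClass ι]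
  {Q : Matrix ι ι ℝ} {p : ι → ℤ → ℝ} {μ : ι → ℤ → Measure (ℕ → ι × ℤ)}

theorem measure_cylinder_inter_visit (hQ : ∀ α β, 0 ≤ Q α β)
    (hp : ∀ α k, p α k ∈ Set.Ioo (0 : ℝ) 1) (hμ : IsQuenchedLaw Q p μ) (α : ι) (i ℓ : ℤ)
    (N n : ℕ) (t : ℕ → ι × ℤ) :
    μ α i ({ω | ∀ k ≤ n, ω k = t k} ∩ {ω | ∃ k, n < k ∧ k ≤ n + N ∧ (ω k).2 = ℓ}) =
      μ α i {ω | ∀ k ≤ n, ω k = t k} * hitProb Q p ℓ N (t n) := by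
  induction N generalizing n t with
  | zero =>
    have : {ω : ℕ → ι × ℤ | ∃ k, n < k ∧ k ≤ n + 0 ∧ (ω k).2 = ℓ} = ∅ := by
      ext ω
      simp only [Set.mem_ofPred_eq, Set.mem_empty_iff_false, iff_false]
      rintro ⟨k, h1, h2, -⟩
      omega
    rw [this]
    simp [hitProb]
  | succ N ih =>
    set t' : ι × ℤ → ℕ → ι × ℤ := fun s => Function.update t (n + 1) s with ht'
    have ht'n : ∀ s, t' s (n + 1) = s := fun s => by simp [ht']
    have ht'k : ∀ s k, k ≤ n → t' s k = t k := fun s k hk => by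
      simp [ht', Function.update_of_ne (show k ≠ n + 1 by omega)]
    have hcyl : ∀ s (ω : ℕ → ι × ℤ),
        (∀ k ≤ n + 1, ω k = t' s k) ↔ (∀ k ≤ n, ω k = t k) ∧ ω (n + 1) = s := by
      intro s ω
      constructor
      · intro h
        exact ⟨fun k hk => (h k (by omega)).trans (ht'k s k hk), (h _ le_rfl).trans (ht'n s)⟩
      · rintro ⟨h1, h2⟩ k hk
        rcases Nat.lt_or_ge n k with h | h
        · obtain rfl : k = n + 1 := by omega
          rw [h2, ht'n]
        · rw [h1 k h, ht'k s k h]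
    have hstep : ∀ s, μ α i {ω | ∀ k ≤ n + 1, ω k = t' s k} =
        μ α i {ω | ∀ k ≤ n, ω k = t k} * ENNReal.ofReal (step Q p (t n) s) := by
      intro s
      rw [(hμ α i).2, (hμ α i).2, Finset.prod_range_succ, ht'n, ht'k s n le_rfl,
        ht'k s 0 (Nat.zero_le n), ENNReal.ofReal_mul
          (Finset.prod_nonneg fun k _ => step_nonneg hQ hp _ _), mul_assoc]
      congr 3
      refine Finset.prod_congr rfl fun k hk => ?_
      rw [Finset.mem_range] at hk
      rw [ht'k s k hk.le, ht'k s (k + 1) hk]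
    set A : ι × ℤ → Set (ℕ → ι × ℤ) := fun s => {ω | ∀ k ≤ n + 1, ω k = t' s k} ∩
      {ω | ∃ k, n < k ∧ k ≤ n + (N + 1) ∧ (ω k).2 = ℓ} with hA
    have hAU : {ω : ℕ → ι × ℤ | ∀ k ≤ n, ω k = t k} ∩
        {ω | ∃ k, n < k ∧ k ≤ n + (N + 1) ∧ (ω k).2 = ℓ} = ⋃ s, A s := by
      ext ω
      simp only [hA, Set.mem_iUnion, Set.mem_inter_iff, Set.mem_ofPred_eq, hcyl]
      exact ⟨fun h => ⟨ω (n + 1), ⟨h.1, rfl⟩, h.2⟩, fun ⟨s, h1, h2⟩ => ⟨h1.1, h2⟩⟩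
    have hAd : Pairwise (Function.onFun Disjoint A) := by
      intro s s' hss
      refine Set.disjoint_left.2 fun ω h h' => hss ?_
      exact ((hcyl s ω).1 h.1).2.symm.trans ((hcyl s' ω).1 h'.1).2
    rw [hAU, measure_iUnion hAd fun s =>
      (measurableSet_cylinder _ _).inter (measurableSet_exists_visit _ _ _), hitProb,
      ← ENNReal.tsum_mul_left]
    refine tsum_congr fun s => ?_
    rw [← mul_assoc, ← hstep s]
    split_ifs with hs
    · rw [mul_one]
      congr 1
      refine Set.inter_eq_left.2 fun ω hω => ⟨n + 1, by omega, by omega, ?_⟩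
      rw [((hcyl s ω).1 hω).2, hs]
    · have := ih (n + 1) (t' s)
      rw [ht'n] at this
      rw [← this]
      congr 1
      ext ω
      simp only [hA, Set.mem_inter_iff, Set.mem_ofPred_eq, and_congr_right_iff]
      intro hω
      constructor
      · rintro ⟨k, h1, h2, h3⟩
        refine ⟨k, lt_of_le_of_ne h1 ?_, by omega, h3⟩
        rintro rfl
        exact hs (((hcyl s ω).1 hω).2 ▸ h3)
      · rintro ⟨k, h1, h2, h3⟩
        exact ⟨k, by omega, by omega, h3⟩

theorem measure_hitEvent (hQ : ∀ α β, 0 ≤ Q α β) (hp : ∀ α k, p α k ∈ Set.Ioo (0 : ℝ) 1)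
    (hμ : IsQuenchedLaw Q p μ) (α : ι) (i ℓ : ℤ) :
    μ α i (hitEvent ℓ) = ⨆ N, hitProb Q p ℓ N (α, i) := by
  have := (hμ α i).1
  have h0 : μ α i {ω | ∀ k ≤ 0, ω k = (fun _ => (α, i) : ℕ → ι × ℤ) k} = 1 := by
    rw [(hμ α i).2]
    simp
  have hU : (hitEvent ℓ : Set (ℕ → ι × ℤ)) =
      ⋃ N : ℕ, {ω | ∃ k, 0 < k ∧ k ≤ 0 + N ∧ (ω k).2 = ℓ} := by
    ext ω
    simp only [hitEvent, Set.mem_ofPred_eq, Set.mem_iUnion]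
    exact ⟨fun ⟨n, h1, h2⟩ => ⟨n, n, h1, by omega, h2⟩, fun ⟨N, n, h1, _, h2⟩ => ⟨n, h1, h2⟩⟩
  have hmono : Monotone fun N : ℕ => {ω : ℕ → ι × ℤ | ∃ k, 0 < k ∧ k ≤ 0 + N ∧ (ω k).2 = ℓ} :=
    fun N M h ω ⟨k, h1, h2, h3⟩ => ⟨k, h1, by omega, h3⟩
  rw [hU, hmono.measure_iUnion]
  refine iSup_congr fun N => ?_
  have h := measure_cylinder_inter_visit hQ hp hμ α i ℓ N 0 fun _ => (α, i)
  rw [h0, one_mul] at h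
  rw [← h, Set.inter_comm]
  refine (measure_inter_conull ?_).symm
  exact (prob_compl_eq_zero_iff (measurableSet_cylinder _ _)).2 h0

theorem fnorm_eq_toReal_hitSup (hQ : ∀ α β, 0 ≤ Q α β)
    (hp : ∀ α k, p α k ∈ Set.Ioo (0 : ℝ) 1) (hμ : IsQuenchedLaw Q p μ) (i j : ℤ) :
    fnorm μ i j = (hitSup Q p i j).toReal := by
  have := fun α => (hμ α i).1
  rw [hitSup, ENNReal.toReal_iSup]
  · simp_rw [← measure_hitEvent hQ hp hμ]
    rfl
  · intro α
    rw [← measure_hitEvent hQ hp hμ]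
    exact measure_ne_top _ _

theorem hitSup_le_one (hQ : ∀ α β, 0 ≤ Q α β) (hp : ∀ α k, p α k ∈ Set.Ioo (0 : ℝ) 1)
    (hμ : IsQuenchedLaw Q p μ) (i j : ℤ) : hitSup Q p i j ≤ 1 := by
  refine iSup_le fun α => ?_
  have := (hμ α i).1
  rw [← measure_hitEvent hQ hp hμ]
  exact prob_le_one

end Law

/-! ### Stationary two-parameter processes -/

section TwoParameter

variable {Ω : Type*} {T : Ω → Ω} {L : ℤ → ℤ → Ω → ℝ≥0∞}

theorem iterate_shift (hshift : ∀ i j x, L i j (T x) = L (i + 1) (j + 1) x) (n : ℕ) (i j : ℤ)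
    (x : Ω) : L i j (T^[n] x) = L (i + n) (j + n) x := by
  induction n generalizing x with
  | zero => simp
  | succ n ih =>
    rw [Function.iterate_succ_apply, ih, hshift]
    push_cast
    simp only [add_assoc]

variable [MeasurableSpace Ω] {P : Measure Ω}

theorem lintegral_shift (hT : MeasurePreserving T P P) (hLm : ∀ i j, Measurable (L i j))
    (hshift : ∀ i j x, L i j (T x) = L (i + 1) (j + 1) x) (i j a : ℤ) :
    ∫⁻ x, L (i + a) (j + a) x ∂P = ∫⁻ x, L i j x ∂P := by
  have h1 : ∀ i j, ∫⁻ x, L (i + 1) (j + 1) x ∂P = ∫⁻ x, L i j x ∂P := fun i j => by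
    simp_rw [← hshift]
    exact hT.lintegral_comp (hLm i j)
  induction a using Int.induction_on with
  | zero => simp
  | succ n ih =>
    rw [← ih, ← add_assoc, ← add_assoc]
    exact h1 _ _
  | pred n ih =>
    rw [← ih, ← h1 (i + (-n - 1)), add_assoc, add_assoc, sub_add_cancel]

variable [IsProbabilityMeasure P]

/-- Superadditive ergodic theorem for a stationary process `L (ℓ + n) ℓ`. -/
theorem exists_rate_add (hT : Ergodic T P) (hLm : ∀ i j, Measurable (L i j))
    (hshift : ∀ i j x, L i j (T x) = L (i + 1) (j + 1) x)
    (hsup : ∀ i j k x, k < j → j < i → L i j x + L j k x ≤ L i k x) (ℓ : ℤ) :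
    ∃ γ : ℝ≥0∞, ∫⁻ x, L 1 0 x ∂P ≤ γ ∧
      ∀ᵐ x ∂P, Tendsto (fun n : ℕ => L (ℓ + n) ℓ x / n) atTop (𝓝 γ) := by
  obtain ⟨γ, h1, h2⟩ := exists_tendsto_of_isSuperadditive (b := fun n => L (ℓ + n) ℓ) hT
    (fun n => hLm _ _) fun m n x hm hn => by
      change L (ℓ + m) ℓ x + L (ℓ + n) ℓ (T^[m] x) ≤ L (ℓ + (m + n : ℕ)) ℓ x
      rw [iterate_shift hshift, add_comm (L _ _ x), show ℓ + n + m = ℓ + (m + n : ℕ) by lia]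
      exact hsup _ _ _ _ (by lia) (by lia)
  refine ⟨γ, ?_, h2⟩
  rw [← lintegral_shift hT.toMeasurePreserving hLm hshift 1 0 ℓ]
  simpa [add_comm] using h1

/-- Superadditive ergodic theorem for a stationary process `L (ℓ - n) ℓ`. As `T` need not be
invertible, it is applied to the backward shift on the space of trajectories of `L`. -/
theorem exists_rate_sub (hT : Ergodic T P) (hLm : ∀ i j, Measurable (L i j))
    (hshift : ∀ i j x, L i j (T x) = L (i + 1) (j + 1) x)
    (hsup : ∀ i j k x, i < j → j < k → L i j x + L j k x ≤ L i k x) (ℓ : ℤ) :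
    ∃ γ : ℝ≥0∞, ∫⁻ x, L 0 1 x ∂P ≤ γ ∧
      ∀ᵐ x ∂P, Tendsto (fun n : ℕ => L (ℓ - n) ℓ x / n) atTop (𝓝 γ) := by
  let Y := {y : ℤ → ℤ → ℝ≥0∞ // ∀ i j k, i < j → j < k → y i j + y j k ≤ y i k}
  let φ : Ω → Y := fun x => ⟨fun i j => L i j x, fun i j k => hsup i j k x⟩
  let S : Y → Y := fun y => ⟨fun i j => y.1 (i - 1) (j - 1),
    fun i j k h h' => y.2 _ _ _ (by omega) (by omega)⟩
  have heval : ∀ i j, Measurable fun y : Y => y.1 i j := fun i j =>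
    (measurable_pi_apply j).comp ((measurable_pi_apply i).comp measurable_subtype_coe)
  have hφ : Measurable φ := Measurable.subtype_mk
    (measurable_pi_lambda _ fun i => measurable_pi_lambda _ fun j => hLm i j)
  have hS : Measurable S := Measurable.subtype_mk
    (measurable_pi_lambda _ fun i => measurable_pi_lambda _ fun j => heval _ _)
  have hSφ : ∀ x, S (φ (T x)) = φ x := fun x => Subtype.ext <| funext fun i => funext fun j => by
    change L (i - 1) (j - 1) (T x) = L i j x
    rw [hshift, sub_add_cancel, sub_add_cancel]
  have hiter : ∀ (m : ℕ) (y : Y) i j, (S^[m] y).1 i j = y.1 (i - m) (j - m) := by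
    intro m
    induction m with
    | zero => simp
    | succ m ih =>
      intro y i j
      rw [Function.iterate_succ_apply, ih]
      change y.1 _ _ = _
      push_cast
      simp only [sub_sub]
  have := Measure.isProbabilityMeasure_map (μ := P) hφ.aemeasurable
  obtain ⟨γ, h1, h2⟩ := exists_tendsto_of_isSuperadditive
    (b := fun n (y : Y) => y.1 (ℓ - n) ℓ) (ergodic_map_of_comp_comp_eq hT hφ hS hSφ)
    (fun n => heval _ _) fun m n y hm hn => by
      change y.1 (ℓ - m) ℓ + (S^[m] y).1 (ℓ - n) ℓ ≤ y.1 (ℓ - (m + n : ℕ)) ℓ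
      rw [hiter, add_comm (y.1 _ _), show ℓ - n - m = ℓ - (m + n : ℕ) by lia]
      exact y.2 _ _ _ (by lia) (by lia)
  refine ⟨γ, ?_, ae_of_ae_map hφ.aemeasurable h2⟩
  rw [lintegral_map (heval _ _) hφ] at h1
  rw [← lintegral_shift hT.toMeasurePreserving hLm hshift 0 1 (ℓ - 1)]
  simpa [φ] using h1

end TwoParameter

theorem coe_log_div_eq_neg {x : ℝ} (hx0 : 0 ≤ x) (hx1 : x ≤ 1) {n : ℕ} (hn : 0 < n) :
    ((Real.log x / n : ℝ) : EReal) = -((ENNReal.ofReal (-Real.log x) / n : ℝ≥0∞) : EReal) := by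
  have hlog := Real.log_nonpos hx0 hx1
  rw [← ENNReal.ofReal_natCast n, ← ENNReal.ofReal_div_of_pos (by exact_mod_cast hn),
    EReal.coe_ennreal_ofReal, max_eq_left (by apply div_nonneg <;> simp [hlog]), neg_div]
  simp

theorem tendsto_coe_log_div {x : ℕ → ℝ} (hx0 : ∀ n, 0 ≤ x n) (hx1 : ∀ n, x n ≤ 1) {γ : ℝ≥0∞}
    (h : Tendsto (fun n : ℕ => ENNReal.ofReal (-Real.log (x n)) / n) atTop (𝓝 γ)) :
    Tendsto (fun n : ℕ => ((Real.log (x n) / n : ℝ) : EReal)) atTop (𝓝 (-(γ : EReal))) := by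
  refine ((continuous_neg.tendsto _).comp
    ((continuous_coe_ennreal_ereal.tendsto _).comp h)).congr' ?_
  filter_upwards [eventually_gt_atTop 0] with n hn
  exact (coe_log_div_eq_neg (hx0 n) (hx1 n) hn).symm

/-! ### Statement 5: Proposition `prop:time4` -/

theorem stmt5_prop_time4 {m : ℕ} (hm : 0 < m)
    {E : Type*} [MeasurableSpace E] (P : Measure E) [IsProbabilityMeasure P]
    (hPc : P.IsComplete) (T : E → E) (hT : Ergodic T P)
    (Q : Matrix (Fin m) (Fin m) ℝ)
    (hQ0 : ∀ α β, 0 ≤ Q α β) (hQ1 : ∀ α, ∑ β, Q α β = 1)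
    (p : Fin m → ℤ → E → ℝ) (hpmeas : ∀ α k, Measurable (p α k))
    (hp01 : ∀ α k e, p α k e ∈ Set.Ioo (0 : ℝ) 1)
    (hpT : ∀ α k e, p α k (T e) = p α (k + 1) e)
    (μ : E → Fin m → ℤ → Measure (ℕ → Fin m × ℤ))
    (hμ : ∀ e, IsQuenchedLaw Q (fun α k => p α k e) (μ e))
    (ℓ : ℤ) :
    (∀ (e : E) (n : ℕ), 1 ≤ n →
      fnorm (μ e) (ℓ - n) ℓ ≤ ∏ k ∈ Finset.Icc 1 n, fnorm (μ e) (ℓ - k) (ℓ - k + 1)) ∧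
    Ergodic shiftSeq (P.map fun e => fun k : ℕ => fnorm (μ e) (ℓ - (k + 1)) (ℓ - k)) ∧
    (∃ γm : EReal,
      (∀ᵐ e ∂P, Tendsto
        (fun n : ℕ => ((Real.log (fnorm (μ e) (ℓ - n) ℓ) / n : ℝ) : EReal)) atTop (𝓝 γm)) ∧
      γm ≤ -(((∫⁻ e, ENNReal.ofReal (-Real.log (fnorm (μ e) 0 1)) ∂P : ℝ≥0∞) : EReal)) ∧
      -(((∫⁻ e, ENNReal.ofReal (-Real.log (fnorm (μ e) 0 1)) ∂P : ℝ≥0∞) : EReal)) ≤ 0) ∧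
    (∀ (e : E) (n : ℕ), 1 ≤ n →
      fnorm (μ e) (ℓ + n) ℓ ≤ ∏ k ∈ Finset.Icc 1 n, fnorm (μ e) (ℓ + k) (ℓ + k - 1)) ∧
    Ergodic shiftSeq (P.map fun e => fun k : ℕ => fnorm (μ e) (ℓ + (k + 1)) (ℓ + k)) ∧
    (∃ γp : EReal,
      (∀ᵐ e ∂P, Tendsto
        (fun n : ℕ => ((Real.log (fnorm (μ e) (ℓ + n) ℓ) / n : ℝ) : EReal)) atTop (𝓝 γp)) ∧
      γp ≤ -(((∫⁻ e, ENNReal.ofReal (-Real.log (fnorm (μ e) 1 0)) ∂P : ℝ≥0∞) : EReal)) ∧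
      -(((∫⁻ e, ENNReal.ofReal (-Real.log (fnorm (μ e) 1 0)) ∂P : ℝ≥0∞) : EReal)) ≤ 0) := by
  have : Nonempty (Fin m) := ⟨⟨0, hm⟩⟩
  have hp : ∀ e α k, p α k e ∈ Set.Ioo (0 : ℝ) 1 := fun e α k => hp01 α k e
  have hf : ∀ e i j, fnorm (μ e) i j = (hitSup Q (fun α k => p α k e) i j).toReal :=
    fun e => fnorm_eq_toReal_hitSup hQ0 (hp e) (hμ e)
  have hone : ∀ e i j, hitSup Q (fun α k => p α k e) i j ≤ 1 :=
    fun e => hitSup_le_one hQ0 (hp e) (hμ e)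
  have htop : ∀ e i j, hitSup Q (fun α k => p α k e) i j ≠ ∞ :=
    fun e i j => ne_top_of_le_ne_top ENNReal.one_ne_top (hone e i j)
  have hf0 : ∀ e i j, 0 ≤ fnorm (μ e) i j := fun e i j => hf e i j ▸ ENNReal.toReal_nonneg
  have hf1 : ∀ e i j, fnorm (μ e) i j ≤ 1 := fun e i j => by
    rw [hf]
    exact ENNReal.toReal_le_of_le_ofReal zero_le_one (by simpa using hone e i j)
  have hfpos : ∀ e i j, i ≠ j → 0 < fnorm (μ e) i j := fun e i j h => by
    rw [hf]
    exact ENNReal.toReal_pos (hitSup_pos hQ1 (hp e) h).ne' (htop e i j)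
  have hfm : ∀ i j, Measurable fun e => fnorm (μ e) i j := fun i j => by
    simp_rw [hf]
    exact (measurable_hitSup Q hpmeas i j).ennreal_toReal
  have hfT : ∀ i j e, fnorm (μ (T e)) i j = fnorm (μ e) (i + 1) (j + 1) := fun i j e => by
    simp_rw [hf, hpT]
    rw [hitSup_shift Q fun α k => p α k e]
  have hfmul : ∀ e i j k, i < j ∧ j < k ∨ k < j ∧ j < i →
      fnorm (μ e) i k ≤ fnorm (μ e) i j * fnorm (μ e) j k := fun e i j k h => by
    rw [hf, hf, hf, ← ENNReal.toReal_mul]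
    exact ENNReal.toReal_mono (ENNReal.mul_ne_top (htop _ _ _) (htop _ _ _))
      (hitSup_le_mul Q (fun α k => p α k e) h)
  set L : ℤ → ℤ → E → ℝ≥0∞ := fun i j e => ENNReal.ofReal (-Real.log (fnorm (μ e) i j)) with hL
  have hLm : ∀ i j, Measurable (L i j) := fun i j =>
    (Real.measurable_log.comp (hfm i j)).neg.ennreal_ofReal
  have hLT : ∀ i j e, L i j (T e) = L (i + 1) (j + 1) e := fun i j e => by
    simp only [hL, hfT]
  have hLsup : ∀ i j k e, i < j ∧ j < k ∨ k < j ∧ j < i → L i j e + L j k e ≤ L i k e := by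
    intro i j k e h
    have hij := hfpos e i j (by omega)
    have hjk := hfpos e j k (by omega)
    simp only [hL]
    rw [← ENNReal.ofReal_add (neg_nonneg.2 (Real.log_nonpos (hf0 _ _ _) (hf1 _ _ _)))
      (neg_nonneg.2 (Real.log_nonpos (hf0 _ _ _) (hf1 _ _ _))), ← neg_add,
      ← Real.log_mul hij.ne' hjk.ne']
    gcongr
    · exact hfpos e i k (by omega)
    · exact hfmul e i j k h
  have hshift : Measurable shiftSeq := measurable_pi_lambda _ fun n => measurable_pi_apply (n + 1)
  refine ⟨?_, ?_, ?_, ?_, ?_, ?_⟩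
  · intro e n hn
    induction n, hn using Nat.le_induction with
    | base => simp
    | succ n hn ih =>
      rw [Finset.prod_Icc_succ_top (by omega), mul_comm]
      have h := hfmul e (ℓ - (n + 1 : ℕ)) (ℓ - n) ℓ (.inl ⟨by omega, by omega⟩)
      rw [show ℓ - ((n + 1 : ℕ) : ℤ) + 1 = ℓ - n by push_cast; ring]
      exact h.trans (mul_le_mul_of_nonneg_left ih (hf0 _ _ _))
  · refine ergodic_map_of_comp_comp_eq hT (measurable_pi_lambda _ fun k => hfm _ _) hshift
      fun e => funext fun k => ?_
    simp only [shiftSeq, hfT]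
    congr 1 <;> push_cast <;> ring
  · obtain ⟨γ, h1, h2⟩ := exists_rate_sub hT hLm hLT
      (fun i j k e h h' => hLsup i j k e (.inl ⟨h, h'⟩)) ℓ
    refine ⟨-(γ : EReal), ?_, ?_, ?_⟩
    · filter_upwards [h2] with e he
      exact tendsto_coe_log_div (fun n => hf0 _ _ _) (fun n => hf1 _ _ _) he
    · exact EReal.neg_le_neg_iff.2 (EReal.coe_ennreal_le_coe_ennreal_iff.2 h1)
    · exact EReal.neg_le.1 (by simpa using EReal.coe_ennreal_nonneg _)
  · intro e n hn
    induction n, hn using Nat.le_induction with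
    | base => simp
    | succ n hn ih =>
      rw [Finset.prod_Icc_succ_top (by omega), mul_comm]
      have h := hfmul e (ℓ + (n + 1 : ℕ)) (ℓ + n) ℓ (.inr ⟨by omega, by omega⟩)
      rw [show ℓ + ((n + 1 : ℕ) : ℤ) - 1 = ℓ + n by push_cast; ring]
      exact h.trans (mul_le_mul_of_nonneg_left ih (hf0 _ _ _))
  · have hφ : Measurable fun e => fun k : ℕ => fnorm (μ e) (ℓ + (k + 1)) (ℓ + k) :=
      measurable_pi_lambda _ fun k => hfm _ _
    refine (hφ.measurePreserving P).ergodic_of_ergodic_semiconj hT hshift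
      fun e => funext fun k => ?_
    simp only [shiftSeq, hfT]
    congr 1 <;> push_cast <;> ring
  · obtain ⟨γ, h1, h2⟩ := exists_rate_add hT hLm hLT
      (fun i j k e h h' => hLsup i j k e (.inr ⟨h, h'⟩)) ℓ
    refine ⟨-(γ : EReal), ?_, ?_, ?_⟩
    · filter_upwards [h2] with e he
      exact tendsto_coe_log_div (fun n => hf0 _ _ _) (fun n => hf1 _ _ _) he
    · exact EReal.neg_le_neg_iff.2 (EReal.coe_ennreal_le_coe_ennreal_iff.2 h1)
    · exact EReal.neg_le.1 (by simpa using EReal.coe_ennreal_nonneg _)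

end Parrondo
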